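/- Let 𝐗 = (X,𝕏) be a level-2 α-Hölder rough path over V, let 𝐘 = (Y,Y') be an 𝐗-controlled rough path with values in L(W,U) and let 𝐙 = (Z,Z') be an 𝐗-controlled rough path with values in W. Then for every 0 ≤ s ≤ t ≤ T and every finite partition P of [s,t]: ‖∫_P Y dZ − (Y_s(Z_{s,t}) + (Y'_s ⋆ Z'_s)(𝕏_{s,t}))‖ ≤ C_α (‖Y'_0‖ + ‖𝐘‖_{𝐗;α}) (‖Z'_0‖ + ‖𝐙‖_{𝐗;α}) (1 + ‖𝐗‖_α)² (t − s)^{3α}. -/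

import Mathlib

/-!  Common definitions: level-2 rough paths, controlled rough paths,
compensated Riemann sums and rough integrals of a controlled rough path
against another controlled rough path. -/

open scoped BigOperators

noncomputable section

/-- `HBound T β A` : the two-parameter map `A` satisfies a `β`-Hölder bound on the
simplex `{0 ≤ s < t ≤ T}`. -/
def HBound {E : Type*} [NormedAddCommGroup E] (T β : ℝ) (A : ℝ → ℝ → E) : Prop :=
  ∃ C : ℝ, ∀ s t : ℝ, 0 ≤ s → s < t → t ≤ T → ‖A s t‖ ≤ C * (t - s) ^ β

/-- The Hölder seminorm `‖A‖_β = sup_{0 ≤ s < t ≤ T} ‖A_{s,t}‖ / (t-s)^β`, realised as the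
least admissible Hölder constant. -/
def hnorm {E : Type*} [NormedAddCommGroup E] (T β : ℝ) (A : ℝ → ℝ → E) : ℝ :=
  sInf {C : ℝ | 0 ≤ C ∧ ∀ s t : ℝ, 0 ≤ s → s < t → t ≤ T → ‖A s t‖ ≤ C * (t - s) ^ β}

/-- An abstract model of the projective tensor product `V ⊗̂ V`, bundling the canonical
bounded bilinear map `tmul : V × V → V ⊗̂ V` and the pairing `⋆` sending
`A ∈ L(V, L(W,U))` and `B ∈ L(V,W)` to the induced operator `A ⋆ B ∈ L(V ⊗̂ V, U)`,
characterised by `(A ⋆ B)(v₁ ⊗ v₂) = (A v₁)(B v₂)` and `‖A ⋆ B‖ ≤ ‖A‖ ‖B‖`. -/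
structure TensorOps (V V2 W U : Type*)
    [NormedAddCommGroup V] [NormedSpace ℝ V] [NormedAddCommGroup V2] [NormedSpace ℝ V2]
    [NormedAddCommGroup W] [NormedSpace ℝ W] [NormedAddCommGroup U] [NormedSpace ℝ U] where
  tmul : V →L[ℝ] V →L[ℝ] V2
  tmul_le : ∀ a b : V, ‖tmul a b‖ ≤ ‖a‖ * ‖b‖
  spair : (V →L[ℝ] (W →L[ℝ] U)) →L[ℝ] ((V →L[ℝ] W) →L[ℝ] (V2 →L[ℝ] U))
  spair_tmul : ∀ (A : V →L[ℝ] (W →L[ℝ] U)) (B : V →L[ℝ] W) (a b : V),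
    spair A B (tmul a b) = (A a) (B b)
  spair_le : ∀ (A : V →L[ℝ] (W →L[ℝ] U)) (B : V →L[ℝ] W), ‖spair A B‖ ≤ ‖A‖ * ‖B‖

section Defs

variable {V V2 E : Type*}
  [NormedAddCommGroup V] [NormedSpace ℝ V] [NormedAddCommGroup V2] [NormedSpace ℝ V2]
  [NormedAddCommGroup E] [NormedSpace ℝ E]

/-- `(X, XX)` is a level-2 `α`-Hölder rough path on `[0,T]`:
Chen's relation plus the analytic estimates. -/
structure IsRoughPath (T α : ℝ) (tmul : V →L[ℝ] V →L[ℝ] V2)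
    (X : ℝ → V) (XX : ℝ → ℝ → V2) : Prop where
  chen : ∀ s u t : ℝ, 0 ≤ s → s ≤ u → u ≤ t → t ≤ T →
    XX s t = XX s u + XX u t + tmul (X u - X s) (X t - X u)
  x_hold : HBound T α fun s t => X t - X s
  xx_hold : HBound T (2 * α) XX

/-- `‖𝐗‖_α := ‖X‖_α + ‖𝕏‖_{2α}`. -/
def rpNorm (T α : ℝ) (X : ℝ → V) (XX : ℝ → ℝ → V2) : ℝ :=
  hnorm T α (fun s t => X t - X s) + hnorm T (2 * α) XX

/-- `‖𝐗 − 𝐗̃‖_α := ‖X − X̃‖_α + ‖𝕏 − 𝕏̃‖_{2α}`. -/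
def rpDist (T α : ℝ) (X Xt : ℝ → V) (XX XXt : ℝ → ℝ → V2) : ℝ :=
  hnorm T α (fun s t => (X t - X s) - (Xt t - Xt s)) +
    hnorm T (2 * α) fun s t => XX s t - XXt s t

/-- The remainder `R^{𝐘}_{s,t} := Y_{s,t} − Y'_s(X_{s,t})` of a controlled rough path. -/
def Rem (X : ℝ → V) (Y : ℝ → E) (Y' : ℝ → V →L[ℝ] E) (s t : ℝ) : E :=
  Y t - Y s - Y' s (X t - X s)

/-- `(Y, Y')` is an `𝐗`-controlled rough path on `[0,T]` with values in `E`. -/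
structure IsCRP (T α : ℝ) (X : ℝ → V) (Y : ℝ → E) (Y' : ℝ → V →L[ℝ] E) : Prop where
  deriv_hold : HBound T α fun s t => Y' t - Y' s
  rem_hold : HBound T (2 * α) (Rem X Y Y')

/-- `‖𝐘‖_{𝐗;α} := ‖R^{𝐘}‖_{2α} + ‖Y'‖_α`. -/
def crpNorm (T α : ℝ) (X : ℝ → V) (Y : ℝ → E) (Y' : ℝ → V →L[ℝ] E) : ℝ :=
  hnorm T (2 * α) (Rem X Y Y') + hnorm T α fun s t => Y' t - Y' s

/-- `d_{𝐗,𝐗̃;α}(𝐘,𝐘̃) := ‖R^{𝐘} − R^{𝐘̃}‖_{2α} + ‖Y' − Ỹ'‖_α`. -/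
def crpDist (T α : ℝ) (X Xt : ℝ → V) (Y : ℝ → E) (Y' : ℝ → V →L[ℝ] E)
    (Yt : ℝ → E) (Yt' : ℝ → V →L[ℝ] E) : ℝ :=
  hnorm T (2 * α) (fun s t => Rem X Y Y' s t - Rem Xt Yt Yt' s t) +
    hnorm T α fun s t => (Y' t - Y' s) - (Yt' t - Yt' s)

/-- `p` is a finite partition `s = p 0 < p 1 < ⋯ < p n = t` of `[s,t]`. -/
def IsPartition (s t : ℝ) (n : ℕ) (p : ℕ → ℝ) : Prop :=
  p 0 = s ∧ p n = t ∧ ∀ i < n, p i < p (i + 1)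

end Defs

section Sums

variable {V V2 W U : Type*}
  [NormedAddCommGroup V] [NormedSpace ℝ V] [NormedAddCommGroup V2] [NormedSpace ℝ V2]
  [NormedAddCommGroup W] [NormedSpace ℝ W] [NormedAddCommGroup U] [NormedSpace ℝ U]

/-- The compensated Riemann sum
`∫_P Y dZ := Σ_i [ Y_{t_i}(Z_{t_i,t_{i+1}}) + (Y'_{t_i} ⋆ Z'_{t_i})(𝕏_{t_i,t_{i+1}}) ]`. -/
def rsum (tops : TensorOps V V2 W U) (XX : ℝ → ℝ → V2)
    (Y : ℝ → W →L[ℝ] U) (Y' : ℝ → V →L[ℝ] (W →L[ℝ] U))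
    (Z : ℝ → W) (Z' : ℝ → V →L[ℝ] W) (n : ℕ) (p : ℕ → ℝ) : U :=
  ∑ i ∈ Finset.range n,
    ((Y (p i)) (Z (p (i + 1)) - Z (p i)) +
      (tops.spair (Y' (p i)) (Z' (p i))) (XX (p i) (p (i + 1))))

/-- `I` is the rough integral `∫_s^t Y dZ`: the limit of the compensated Riemann sums
as the mesh of the partition tends to `0`. -/
def IsRoughIntegral (tops : TensorOps V V2 W U) (XX : ℝ → ℝ → V2)
    (Y : ℝ → W →L[ℝ] U) (Y' : ℝ → V →L[ℝ] (W →L[ℝ] U))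
    (Z : ℝ → W) (Z' : ℝ → V →L[ℝ] W) (s t : ℝ) (I : U) : Prop :=
  ∀ ε : ℝ, 0 < ε → ∃ δ : ℝ, 0 < δ ∧ ∀ (n : ℕ) (p : ℕ → ℝ), IsPartition s t n p →
    (∀ i < n, p (i + 1) - p i < δ) → ‖rsum tops XX Y Y' Z Z' n p - I‖ ≤ ε

end Sums

/-- The constant `C_α := (1 + T^α + T^{2α}) · 2^{3α} · Σ_{n≥1} n^{-3α}`. -/
def Calpha (T α : ℝ) : ℝ :=
  (1 + T ^ α + T ^ (2 * α)) * (2 : ℝ) ^ (3 * α) * ∑' n : ℕ, ((n : ℝ) + 1) ^ (-(3 * α))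

/-- `F ∈ C_b^k`: `k` times continuously Fréchet differentiable with all derivatives
up to order `k` bounded. -/
def IsCb {E₁ E₂ : Type*} [NormedAddCommGroup E₁] [NormedSpace ℝ E₁]
    [NormedAddCommGroup E₂] [NormedSpace ℝ E₂] (k : ℕ) (F : E₁ → E₂) : Prop :=
  ContDiff ℝ (k : ℕ∞) F ∧ ∀ j ≤ k, ∃ C : ℝ, ∀ x, ‖iteratedFDeriv ℝ j F x‖ ≤ C

/-- `‖F‖_{C_b^k} := Σ_{j=0}^k sup_x ‖D^j F(x)‖`. -/
def cbNorm {E₁ E₂ : Type*} [NormedAddCommGroup E₁] [NormedSpace ℝ E₁]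
    [NormedAddCommGroup E₂] [NormedSpace ℝ E₂] (k : ℕ) (F : E₁ → E₂) : ℝ :=
  ∑ j ∈ Finset.range (k + 1), ⨆ x : E₁, ‖iteratedFDeriv ℝ j F x‖

end

section HolderConstants

variable {E : Type*} [NormedAddCommGroup E] {T β : ℝ} {A : ℝ → ℝ → E}

lemma hnorm_nonneg : 0 ≤ hnorm T β A :=
  Real.sInf_nonneg fun _ h => h.1

lemma HBound.norm_le_hnorm (h : HBound T β A) {s t : ℝ} (hs : 0 ≤ s) (hst : s < t)
    (ht : t ≤ T) : ‖A s t‖ ≤ hnorm T β A * (t - s) ^ β := by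
  have hpos : 0 < (t - s) ^ β := Real.rpow_pos_of_pos (sub_pos.2 hst) β
  rw [← div_le_iff₀ hpos]
  obtain ⟨C, hC⟩ := h
  refine le_csInf ⟨max C 0, le_max_right _ _, fun s t hs hst ht => (hC s t hs hst ht).trans ?_⟩ ?_
  · exact mul_le_mul_of_nonneg_right (le_max_left _ _) (Real.rpow_nonneg (sub_pos.2 hst).le β)
  · rintro c ⟨-, hc⟩
    exact (div_le_iff₀ hpos).2 (hc s t hs hst ht)

end HolderConstants

lemma HBound.norm_le_add_rpow {E : Type*} [NormedAddCommGroup E] {T α : ℝ} {f : ℝ → E}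
    (hT : 0 < T) (hα : 0 < α) (h : HBound T α fun s t => f t - f s)
    {u : ℝ} (hu : 0 ≤ u) (huT : u ≤ T) :
    ‖f u‖ ≤ ‖f 0‖ + hnorm T α (fun s t => f t - f s) * T ^ α := by
  have hn : 0 ≤ hnorm T α (fun s t => f t - f s) := hnorm_nonneg
  rcases hu.eq_or_lt with rfl | hu
  · have : 0 ≤ T ^ α := Real.rpow_nonneg hT.le α
    nlinarith [mul_nonneg hn this]
  · have h1 := h.norm_le_hnorm le_rfl hu huT
    have h2 : (u - 0) ^ α ≤ T ^ α := Real.rpow_le_rpow (by linarith) (by linarith) hα.le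
    have h3 : f u = f 0 + (f u - f 0) := by abel
    calc ‖f u‖ ≤ ‖f 0‖ + ‖f u - f 0‖ := by
          conv_lhs => rw [h3]
          exact norm_add_le _ _
      _ ≤ _ := by
          gcongr
          exact h1.trans (mul_le_mul_of_nonneg_left h2 hn)

section Sewing

lemma sum_range_skip {E : Type*} [AddCommGroup E] (Ξ : ℝ → ℝ → E) (p : ℕ → ℝ) (i m : ℕ) :
    ∑ j ∈ Finset.range (i + 1 + 1 + m), Ξ (p j) (p (j + 1)) =
      ∑ j ∈ Finset.range (i + 1 + m), Ξ (if j ≤ i then p j else p (j + 1))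
          (if j + 1 ≤ i then p (j + 1) else p (j + 1 + 1)) +
        (Ξ (p i) (p (i + 1)) + Ξ (p (i + 1)) (p (i + 2)) - Ξ (p i) (p (i + 2))) := by
  have h1 : ∑ j ∈ Finset.range i, Ξ (if j ≤ i then p j else p (j + 1))
      (if j + 1 ≤ i then p (j + 1) else p (j + 1 + 1)) =
        ∑ j ∈ Finset.range i, Ξ (p j) (p (j + 1)) := by
    refine Finset.sum_congr rfl fun j hj => ?_
    have := Finset.mem_range.1 hj
    rw [if_pos (by omega), if_pos (by omega)]
  have h2 : ∑ j ∈ Finset.range m, Ξ (if i + 1 + j ≤ i then p (i + 1 + j) else p (i + 1 + j + 1))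
      (if i + 1 + j + 1 ≤ i then p (i + 1 + j + 1) else p (i + 1 + j + 1 + 1)) =
        ∑ j ∈ Finset.range m, Ξ (p (i + 1 + 1 + j)) (p (i + 1 + 1 + j + 1)) := by
    refine Finset.sum_congr rfl fun j _ => ?_
    rw [if_neg (by omega), if_neg (by omega), show i + 1 + j + 1 = i + 1 + 1 + j by omega]
  rw [Finset.sum_range_add, Finset.sum_range_add _ (i + 1) m, h2, Finset.sum_range_succ,
    Finset.sum_range_succ, Finset.sum_range_succ _ i, h1, if_pos le_rfl, if_neg (by omega)]
  abel

lemma IsPartition.le_of_le {s t : ℝ} {n : ℕ} {p : ℕ → ℝ} (hp : IsPartition s t n p)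
    {i j : ℕ} (hij : i ≤ j) (hj : j ≤ n) : p i ≤ p j := by
  induction j, hij using Nat.le_induction with
  | base => exact le_rfl
  | succ k _ ih => exact (ih (by omega)).trans (hp.2.2 k (by omega)).le

lemma IsPartition.skip {s t : ℝ} {n i : ℕ} {p : ℕ → ℝ} (hp : IsPartition s t (n + 1) p)
    (hi : i < n) : IsPartition s t n fun j => if j ≤ i then p j else p (j + 1) := by
  refine ⟨by simpa using hp.1, by simpa [hi.not_ge] using hp.2.1, fun j hj => ?_⟩
  have h1 := hp.2.2 j (by omega)
  have h2 := hp.2.2 (j + 1) (by omega)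
  dsimp only
  split_ifs <;> first | omega | linarith

lemma IsPartition.exists_short_pair {s t : ℝ} {n : ℕ} {p : ℕ → ℝ}
    (hp : IsPartition s t (n + 2) p) :
    ∃ i < n + 1, p (i + 2) - p i ≤ 2 * (t - s) * ((n : ℝ) + 1)⁻¹ := by
  by_contra! h
  have h1 : ∑ i ∈ Finset.range (n + 1), 2 * (t - s) * ((n : ℝ) + 1)⁻¹ <
      ∑ i ∈ Finset.range (n + 1), (p (i + 2) - p i) :=
    Finset.sum_lt_sum_of_nonempty (by simp) fun i hi => h i (Finset.mem_range.1 hi)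
  have h2 : ∑ i ∈ Finset.range (n + 1), (p (i + 2) - p i) =
      (p (n + 2) - p 1) + (p (n + 1) - p 0) := by
    rw [← Finset.sum_range_sub p (n + 1), ← Finset.sum_range_sub (fun i => p (i + 1)) (n + 1),
      ← Finset.sum_add_distrib]
    exact Finset.sum_congr rfl fun i _ => by ring
  have h3 : ∑ i ∈ Finset.range (n + 1), 2 * (t - s) * ((n : ℝ) + 1)⁻¹ = 2 * (t - s) := by
    rw [Finset.sum_const, Finset.card_range, nsmul_eq_mul]
    push_cast
    field_simp
  have h4 := hp.le_of_le (i := 0) (j := 1) (by omega) (by omega)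
  have h5 := hp.le_of_le (i := n + 1) (j := n + 2) (by omega) (by omega)
  have h6 := hp.1
  have h7 := hp.2.1
  linarith

/-- Young's point-removal estimate for the Riemann sums of an almost additive map. -/
lemma norm_sum_sub_le_of_almost_additive {E : Type*} [NormedAddCommGroup E] {T K γ : ℝ}
    (hK : 0 ≤ K) (hγ : 0 ≤ γ) {Ξ : ℝ → ℝ → E}
    (hΞ : ∀ s u t : ℝ, 0 ≤ s → s < u → u < t → t ≤ T →
      ‖Ξ s u + Ξ u t - Ξ s t‖ ≤ K * (t - s) ^ γ)
    {s t : ℝ} (hs : 0 ≤ s) (ht : t ≤ T) (n : ℕ) (p : ℕ → ℝ) (hp : IsPartition s t (n + 1) p) :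
    ‖∑ i ∈ Finset.range (n + 1), Ξ (p i) (p (i + 1)) - Ξ s t‖ ≤
      K * (2 ^ γ * (t - s) ^ γ * ∑ k ∈ Finset.range n, ((k : ℝ) + 1) ^ (-γ)) := by
  induction n generalizing p with
  | zero =>
    have h0 := hp.1
    have h1 := hp.2.1
    simp only [zero_add] at h1
    simp [h0, h1]
  | succ n ih =>
    obtain ⟨i, hi, hle⟩ := hp.exists_short_pair
    have hst : s ≤ t := by
      simpa only [hp.1, hp.2.1] using hp.le_of_le (Nat.zero_le (n + 1 + 1)) le_rfl
    have hlo : 0 ≤ p i := by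
      have := hp.le_of_le (Nat.zero_le i) (by omega)
      rw [hp.1] at this
      linarith
    have hhi : p (i + 2) ≤ T := by
      have := hp.le_of_le (i := i + 2) (j := n + 1 + 1) (by omega) le_rfl
      rw [hp.2.1] at this
      linarith
    have hlt1 := hp.2.2 i (by omega)
    have hlt2 : p (i + 1) < p (i + 2) := hp.2.2 (i + 1) (by omega)
    have hdef := hΞ _ _ _ hlo hlt1 hlt2 hhi
    have hpow : (p (i + 2) - p i) ^ γ ≤ 2 ^ γ * (t - s) ^ γ * ((n : ℝ) + 1) ^ (-γ) := by
      have hn : (0 : ℝ) ≤ (n : ℝ) + 1 := by positivity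
      rw [Real.rpow_neg hn, ← Real.inv_rpow hn,
        ← Real.mul_rpow (by norm_num) (sub_nonneg.2 hst),
        ← Real.mul_rpow (by linarith) (inv_nonneg.2 hn)]
      exact Real.rpow_le_rpow (by linarith) hle hγ
    have hIH := ih _ (hp.skip hi)
    obtain ⟨m, rfl⟩ : ∃ m, n = i + m := ⟨n - i, by omega⟩
    have hsum := sum_range_skip Ξ p i m
    rw [show i + 1 + 1 + m = i + m + 1 + 1 by omega, show i + 1 + m = i + m + 1 by omega] at hsum
    rw [hsum, Finset.sum_range_succ (fun k : ℕ => ((k : ℝ) + 1) ^ (-γ)), add_sub_right_comm]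
    refine (norm_add_le _ _).trans ((add_le_add hIH
      (hdef.trans (mul_le_mul_of_nonneg_left hpow hK))).trans_eq ?_)
    ring

end Sewing

/-- The germ of the rough integral of one controlled path against another is almost additive. -/
lemma norm_compensated_germ_defect_le
    {V V2 W U : Type*} [NormedAddCommGroup V] [NormedSpace ℝ V]
    [NormedAddCommGroup V2] [NormedSpace ℝ V2]
    [NormedAddCommGroup W] [NormedSpace ℝ W] [NormedAddCommGroup U] [NormedSpace ℝ U]
    {T α : ℝ} (hT : 0 < T) (hα : 0 < α)
    (tops : TensorOps V V2 W U) {X : ℝ → V} {XX : ℝ → ℝ → V2}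
    (hX : IsRoughPath T α tops.tmul X XX)
    {Y : ℝ → W →L[ℝ] U} {Y' : ℝ → V →L[ℝ] (W →L[ℝ] U)} (hY : IsCRP T α X Y Y')
    {Z : ℝ → W} {Z' : ℝ → V →L[ℝ] W} (hZ : IsCRP T α X Z Z')
    {s u t : ℝ} (hs : 0 ≤ s) (hsu : s < u) (hut : u < t) (htT : t ≤ T) :
    ‖(Y s (Z u - Z s) + tops.spair (Y' s) (Z' s) (XX s u)) +
        (Y u (Z t - Z u) + tops.spair (Y' u) (Z' u) (XX u t)) -
        (Y s (Z t - Z s) + tops.spair (Y' s) (Z' s) (XX s t))‖ ≤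
      (1 + T ^ α + T ^ (2 * α)) * (‖Y' 0‖ + crpNorm T α X Y Y') *
        (‖Z' 0‖ + crpNorm T α X Z Z') * (1 + rpNorm T α X XX) ^ 2 * (t - s) ^ (3 * α) := by
  have hYu := hY.deriv_hold.norm_le_add_rpow hT hα hs (by linarith)
  have hZu := hZ.deriv_hold.norm_le_add_rpow hT hα (u := u) (by linarith) (by linarith)
  have hdY := hY.deriv_hold.norm_le_hnorm hs hsu (by linarith)
  have hdZ := hZ.deriv_hold.norm_le_hnorm hs hsu (by linarith)
  have hrY := hY.rem_hold.norm_le_hnorm hs hsu (by linarith)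
  have hrZ := hZ.rem_hold.norm_le_hnorm (by linarith) hut htT
  have hX1 := hX.x_hold.norm_le_hnorm hs hsu (by linarith)
  have hX2 := hX.x_hold.norm_le_hnorm (by linarith) hut htT
  have hXX := hX.xx_hold.norm_le_hnorm (by linarith) hut htT
  unfold crpNorm rpNorm
  have hdy0 : 0 ≤ hnorm T α (fun s t => Y' t - Y' s) := hnorm_nonneg
  have hdz0 : 0 ≤ hnorm T α (fun s t => Z' t - Z' s) := hnorm_nonneg
  have hry0 : 0 ≤ hnorm T (2 * α) (Rem X Y Y') := hnorm_nonneg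
  have hrz0 : 0 ≤ hnorm T (2 * α) (Rem X Z Z') := hnorm_nonneg
  have hx0 : 0 ≤ hnorm T α (fun s t => X t - X s) := hnorm_nonneg
  have hxx0 : 0 ≤ hnorm T (2 * α) XX := hnorm_nonneg
  have hy0 : 0 ≤ ‖Y' 0‖ := norm_nonneg (Y' 0)
  have hz0 : 0 ≤ ‖Z' 0‖ := norm_nonneg _
  generalize hnorm T α (fun s t => Y' t - Y' s) = dy at *
  generalize hnorm T α (fun s t => Z' t - Z' s) = dz at *
  generalize hnorm T (2 * α) (Rem X Y Y') = ry at *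
  generalize hnorm T (2 * α) (Rem X Z Z') = rz at *
  generalize hnorm T α (fun s t => X t - X s) = x at *
  generalize hnorm T (2 * α) XX = xx at *
  generalize ‖Y' 0‖ = y0 at *
  generalize ‖Z' 0‖ = z0 at *
  have hts : 0 ≤ t - s := by linarith
  have hsq : ∀ r : ℝ, 0 ≤ r → r ^ (2 * α) = (r ^ α) ^ 2 := fun r hr => by
    rw [← Real.rpow_mul_natCast hr, mul_comm]
    norm_num
  have hcube : (t - s) ^ (3 * α) = ((t - s) ^ α) ^ 3 := by
    rw [← Real.rpow_mul_natCast hts, mul_comm]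
    norm_num
  have hD1 : (u - s) ^ α ≤ (t - s) ^ α := Real.rpow_le_rpow (by linarith) (by linarith) hα.le
  have hD2 : (t - u) ^ α ≤ (t - s) ^ α := Real.rpow_le_rpow (by linarith) (by linarith) hα.le
  have hDτ : (t - s) ^ α ≤ T ^ α := Real.rpow_le_rpow hts (by linarith) hα.le
  have h10 : 0 ≤ (u - s) ^ α := Real.rpow_nonneg (by linarith) α
  have h20 : 0 ≤ (t - u) ^ α := Real.rpow_nonneg (by linarith) α
  have hD0 : 0 ≤ (t - s) ^ α := Real.rpow_nonneg hts α
  rw [hsq _ (by linarith)] at hrY hrZ hXX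
  rw [hsq T hT.le, hcube]
  generalize (t - s) ^ α = D at *
  generalize T ^ α = τ at *
  generalize (u - s) ^ α = a at *
  generalize (t - u) ^ α = b at *
  have hτ0 : 0 ≤ τ := hD0.trans hDτ
  replace hdY : ‖Y' u - Y' s‖ ≤ dy * D := hdY.trans (by gcongr)
  replace hdZ : ‖Z' u - Z' s‖ ≤ dz * D := hdZ.trans (by gcongr)
  replace hrY : ‖Rem X Y Y' s u‖ ≤ ry * D ^ 2 := hrY.trans (by gcongr)
  replace hrZ : ‖Rem X Z Z' u t‖ ≤ rz * D ^ 2 := hrZ.trans (by gcongr)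
  replace hX1 : ‖X u - X s‖ ≤ x * D := hX1.trans (by gcongr)
  replace hX2 : ‖X t - X u‖ ≤ x * D := hX2.trans (by gcongr)
  replace hXX : ‖XX u t‖ ≤ xx * D ^ 2 := hXX.trans (by gcongr)
  have hYs0 : 0 ≤ y0 + dy * τ := by positivity
  have hZu0 : 0 ≤ z0 + dz * τ := by positivity
  have e1 : ‖Rem X Y Y' s u (Z' u (X t - X u))‖ ≤ (ry * D ^ 2) * ((z0 + dz * τ) * (x * D)) :=
    ContinuousLinearMap.le_of_opNorm_le_of_le _ hrY
      (ContinuousLinearMap.le_of_opNorm_le_of_le _ hZu hX2)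
  have e2 : ‖Rem X Y Y' s u (Rem X Z Z' u t)‖ ≤ (ry * D ^ 2) * (rz * (D * τ)) :=
    (ContinuousLinearMap.le_of_opNorm_le_of_le _ hrY hrZ).trans (by rw [sq]; gcongr)
  have e3 : ‖Y' s (X u - X s) (Rem X Z Z' u t)‖ ≤ ((y0 + dy * τ) * (x * D)) * (rz * D ^ 2) :=
    ContinuousLinearMap.le_of_opNorm_le_of_le _
      (ContinuousLinearMap.le_of_opNorm_le_of_le _ hYu hX1) hrZ
  have e4 : ‖Y' s (X u - X s) ((Z' u - Z' s) (X t - X u))‖ ≤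
      ((y0 + dy * τ) * (x * D)) * ((dz * D) * (x * D)) :=
    ContinuousLinearMap.le_of_opNorm_le_of_le _
      (ContinuousLinearMap.le_of_opNorm_le_of_le _ hYu hX1)
      (ContinuousLinearMap.le_of_opNorm_le_of_le _ hdZ hX2)
  have e5 : ‖tops.spair (Y' u - Y' s) (Z' u) (XX u t)‖ ≤
      ((dy * D) * (z0 + dz * τ)) * (xx * D ^ 2) :=
    ContinuousLinearMap.le_of_opNorm_le_of_le _
      ((tops.spair_le _ _).trans (by gcongr)) hXX
  have e6 : ‖tops.spair (Y' s) (Z' u - Z' s) (XX u t)‖ ≤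
      ((y0 + dy * τ) * (dz * D)) * (xx * D ^ 2) :=
    ContinuousLinearMap.le_of_opNorm_le_of_le _
      ((tops.spair_le _ _).trans (by gcongr)) hXX
  have key : (Y s (Z u - Z s) + tops.spair (Y' s) (Z' s) (XX s u)) +
        (Y u (Z t - Z u) + tops.spair (Y' u) (Z' u) (XX u t)) -
        (Y s (Z t - Z s) + tops.spair (Y' s) (Z' s) (XX s t)) =
      Rem X Y Y' s u (Z' u (X t - X u)) + Rem X Y Y' s u (Rem X Z Z' u t) +
        Y' s (X u - X s) (Rem X Z Z' u t) + Y' s (X u - X s) ((Z' u - Z' s) (X t - X u)) +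
        tops.spair (Y' u - Y' s) (Z' u) (XX u t) + tops.spair (Y' s) (Z' u - Z' s) (XX u t) := by
    rw [hX.chen s u t hs hsu.le hut.le htT, map_add, map_add, tops.spair_tmul]
    simp only [Rem, map_sub, sub_apply]
    abel
  rw [key]
  refine (norm_add_le_of_le (norm_add_le_of_le (norm_add_le_of_le (norm_add_le_of_le
    (norm_add_le_of_le e1 e2) e3) e4) e5) e6).trans ?_
  have m1 : 1 ≤ (1 + (x + xx)) ^ 2 := by rw [← sub_nonneg]; ring_nf; positivity
  have m2 : x ≤ (1 + (x + xx)) ^ 2 := by rw [← sub_nonneg]; ring_nf; positivity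
  have m3 : x ^ 2 + 2 * xx ≤ (1 + (x + xx)) ^ 2 := by rw [← sub_nonneg]; ring_nf; positivity
  have m4 : x ^ 2 + xx ≤ (1 + (x + xx)) ^ 2 := by linarith
  have m5 : xx ≤ (1 + (x + xx)) ^ 2 := by linarith [sq_nonneg x]
  generalize (1 + (x + xx)) ^ 2 = M at *
  have hM0 : 0 ≤ M := by linarith
  calc _ = (ry * z0 * x + y0 * rz * x + y0 * dz * (x ^ 2 + xx) + dy * z0 * xx +
          τ * (ry * dz * x + ry * rz * 1 + dy * rz * x + dy * dz * (x ^ 2 + 2 * xx))) *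
            D ^ 3 := by ring
    _ ≤ (ry * z0 * M + y0 * rz * M + y0 * dz * M + dy * z0 * M +
          τ * (ry * dz * M + ry * rz * M + dy * rz * M + dy * dz * M)) * D ^ 3 := by gcongr
    _ = (ry * z0 + y0 * rz + y0 * dz + dy * z0 +
          τ * (ry * dz + ry * rz + dy * rz + dy * dz)) * M * D ^ 3 := by ring
    _ ≤ (1 + τ + τ ^ 2) * (y0 + (ry + dy)) * (z0 + (rz + dz)) * M * D ^ 3 := by
      gcongr
      rw [← sub_nonneg]
      ring_nf
      positivity

/-- uniform estimate for compensated Riemann sums. -/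
theorem stmt2
    {V V2 W U : Type*} [NormedAddCommGroup V] [NormedSpace ℝ V] [CompleteSpace V]
    [NormedAddCommGroup V2] [NormedSpace ℝ V2] [CompleteSpace V2]
    [NormedAddCommGroup W] [NormedSpace ℝ W] [CompleteSpace W]
    [NormedAddCommGroup U] [NormedSpace ℝ U] [CompleteSpace U]
    (T α : ℝ) (hT : 0 < T) (hα : 1 / 3 < α) (hα' : α ≤ 1 / 2)
    (tops : TensorOps V V2 W U) (X : ℝ → V) (XX : ℝ → ℝ → V2)
    (hX : IsRoughPath T α tops.tmul X XX)
    (Y : ℝ → W →L[ℝ] U) (Y' : ℝ → V →L[ℝ] (W →L[ℝ] U)) (hY : IsCRP T α X Y Y')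
    (Z : ℝ → W) (Z' : ℝ → V →L[ℝ] W) (hZ : IsCRP T α X Z Z')
    (s t : ℝ) (hs : 0 ≤ s) (hst : s ≤ t) (htT : t ≤ T)
    (n : ℕ) (p : ℕ → ℝ) (hp : IsPartition s t n p) :
    ‖rsum tops XX Y Y' Z Z' n p -
        ((Y s) (Z t - Z s) + (tops.spair (Y' s) (Z' s)) (XX s t))‖ ≤
      Calpha T α * (‖Y' 0‖ + crpNorm T α X Y Y') * (‖Z' 0‖ + crpNorm T α X Z Z') *
        (1 + rpNorm T α X XX) ^ 2 * (t - s) ^ (3 * α) := by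
  have hγ : 1 < 3 * α := by linarith
  have hYn : 0 ≤ ‖Y' 0‖ + crpNorm T α X Y Y' :=
    add_nonneg (norm_nonneg (Y' 0)) (add_nonneg hnorm_nonneg hnorm_nonneg)
  have hZn : 0 ≤ ‖Z' 0‖ + crpNorm T α X Z Z' :=
    add_nonneg (norm_nonneg _) (add_nonneg hnorm_nonneg hnorm_nonneg)
  rcases n with _ | n
  · have hst' : s = t := hp.1.symm.trans hp.2.1
    subst hst'
    have hXX : XX s s = 0 := by
      simpa using hX.chen s s s hs le_rfl le_rfl htT
    simp [rsum, hXX, Real.zero_rpow (by linarith : 3 * α ≠ 0)]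
  · have hK : 0 ≤ (1 + T ^ α + T ^ (2 * α)) * (‖Y' 0‖ + crpNorm T α X Y Y') *
        (‖Z' 0‖ + crpNorm T α X Z Z') * (1 + rpNorm T α X XX) ^ 2 := by positivity
    have hsum : Summable fun k : ℕ => ((k : ℝ) + 1) ^ (-(3 * α)) := by
      have := (summable_nat_add_iff 1).2 (Real.summable_nat_rpow.2 (by linarith : -(3 * α) < -1))
      simpa using this
    have hpart : ∑ k ∈ Finset.range n, ((k : ℝ) + 1) ^ (-(3 * α)) ≤
        ∑' k : ℕ, ((k : ℝ) + 1) ^ (-(3 * α)) :=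
      hsum.sum_le_tsum _ fun k _ => by positivity
    have hts : 0 ≤ (t - s) ^ (3 * α) := Real.rpow_nonneg (by linarith) _
    refine (norm_sum_sub_le_of_almost_additive
      (Ξ := fun s t => Y s (Z t - Z s) + tops.spair (Y' s) (Z' s) (XX s t)) hK
      (by linarith : 0 ≤ 3 * α)
      (fun _ _ _ => norm_compensated_germ_defect_le hT (by linarith) tops hX hY hZ)
      hs htT n p hp).trans ?_
    refine (mul_le_mul_of_nonneg_left (mul_le_mul_of_nonneg_left hpart
      (by positivity)) hK).trans_eq ?_
    unfold Calpha
    ring
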